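/- Under the semi-discrete polygonal evolution law ∂_t X_i = V_i N_i + W_i T_i, the length of each edge evolves according to ∂_t r_i = V_i sin(φ_i/2) + V_{i−1} sin(φ_{i−1}/2) + W_i cos(φ_i/2) − W_{i−1} cos(φ_{i−1}/2) for every i. -/

import Mathlib

open Real

/-- Euclidean norm on the plane `ℝ × ℝ`. -/
noncomputable def norm2 (p : ℝ × ℝ) : ℝ := Real.sqrt (p.1 ^ 2 + p.2 ^ 2)

/-- Rotation by `π/2`: `J(a,b) = (-b,a)`. -/
def Jrot (p : ℝ × ℝ) : ℝ × ℝ := (-p.2, p.1)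

/-- Euclidean dot product on the plane `ℝ × ℝ`. -/
def dot (p q : ℝ × ℝ) : ℝ := p.1 * q.1 + p.2 * q.2

/-- The derivative of the Euclidean length of a nonvanishing plane curve is the component of the
velocity along the unit direction of the curve. -/
theorem HasDerivAt.norm2 {p : ℝ → ℝ × ℝ} {p' : ℝ × ℝ} {t : ℝ} (hp : HasDerivAt p p' t)
    (h0 : p t ≠ 0) :
    HasDerivAt (fun s => norm2 (p s)) (dot ((norm2 (p t))⁻¹ • p t) p') t := by
  have hpos : (p t).1 ^ 2 + (p t).2 ^ 2 ≠ 0 := by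
    intro h
    apply h0
    ext
    · simp only [Prod.fst_zero]; nlinarith [sq_nonneg (p t).1, sq_nonneg (p t).2]
    · simp only [Prod.snd_zero]; nlinarith [sq_nonneg (p t).1, sq_nonneg (p t).2]
  have h1 : HasDerivAt (fun s => (p s).1) p'.1 t := (hasFDerivAt_fst (p := p t)).comp_hasDerivAt t hp
  have h2 : HasDerivAt (fun s => (p s).2) p'.2 t := (hasFDerivAt_snd (p := p t)).comp_hasDerivAt t hp
  refine (((h1.fun_pow 2).fun_add (h2.fun_pow 2)).sqrt hpos).congr_deriv ?_
  simp only [dot, _root_.norm2, Prod.smul_fst, Prod.smul_snd, smul_eq_mul]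
  field_simp
  ring

/-- Under the semi-discrete polygonal evolution law `∂ₜ Xᵢ = Vᵢ Nᵢ + Wᵢ Tᵢ`,
each edge length evolves by
`∂ₜ rᵢ = Vᵢ sin(φᵢ/2) + Vᵢ₋₁ sin(φᵢ₋₁/2) + Wᵢ cos(φᵢ/2) − Wᵢ₋₁ cos(φᵢ₋₁/2)`. -/
theorem polygon_edge_length_derivative
    (N : ℕ) [NeZero N] (hN : 3 ≤ N)
    (X : ℝ → ZMod N → ℝ × ℝ)
    (r θ φ V W : ℝ → ZMod N → ℝ)
    (tv nv Tv Nv : ℝ → ZMod N → ℝ × ℝ)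
    (hX : ∀ t i, X t i ≠ X t (i - 1))
    (hr : ∀ t i, r t i = norm2 (X t i - X t (i - 1)))
    (htv : ∀ t i, tv t i = (r t i)⁻¹ • (X t i - X t (i - 1)))
    (hnv : ∀ t i, nv t i = -Jrot (tv t i))
    (hθ : ∀ t i, tv t i = (cos (θ t i), sin (θ t i)))
    (hφmem : ∀ t i, φ t i ∈ Set.Ioo (-π) π)
    (hφ : ∀ t i, tv t (i + 1) = (cos (θ t i + φ t i), sin (θ t i + φ t i)))
    (hTv : ∀ t i, Tv t i = (cos (θ t i + φ t i / 2), sin (θ t i + φ t i / 2)))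
    (hNv : ∀ t i, Nv t i = -Jrot (Tv t i))
    (hevol : ∀ t i, HasDerivAt (fun s => X s i) (V t i • Nv t i + W t i • Tv t i) t)
    (t : ℝ) :
    ∀ i, HasDerivAt (fun s => r s i)
      (V t i * sin (φ t i / 2) + V t (i - 1) * sin (φ t (i - 1) / 2)
        + W t i * cos (φ t i / 2) - W t (i - 1) * cos (φ t (i - 1) / 2)) t := by
  intro i
  have hd := ((hevol t i).fun_sub (hevol t (i - 1))).norm2 (sub_ne_zero.mpr (hX t i))
  have hu : (norm2 (X t i - X t (i - 1)))⁻¹ • (X t i - X t (i - 1)) = tv t i := by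
    rw [htv, hr]
  have hu' := hφ t (i - 1)
  rw [sub_add_cancel, hθ t i, Prod.mk.injEq] at hu'
  obtain ⟨hcos, hsin⟩ := hu'
  have hs : sin (φ t i / 2) = sin (θ t i + φ t i / 2) * cos (θ t i)
      - cos (θ t i + φ t i / 2) * sin (θ t i) := by
    rw [← sin_sub]; ring_nf
  have hc : cos (φ t i / 2) = cos (θ t i + φ t i / 2) * cos (θ t i)
      + sin (θ t i + φ t i / 2) * sin (θ t i) := by
    rw [← cos_sub]; ring_nf
  have hs' : sin (φ t (i - 1) / 2) = sin (θ t i) * cos (θ t (i - 1) + φ t (i - 1) / 2)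
      - cos (θ t i) * sin (θ t (i - 1) + φ t (i - 1) / 2) := by
    rw [hcos, hsin, ← sin_sub]; ring_nf
  have hc' : cos (φ t (i - 1) / 2) = cos (θ t i) * cos (θ t (i - 1) + φ t (i - 1) / 2)
      + sin (θ t i) * sin (θ t (i - 1) + φ t (i - 1) / 2) := by
    rw [hcos, hsin, ← cos_sub]; ring_nf
  simp only [hr]
  refine hd.congr_deriv ?_
  rw [hu, hθ, hs, hc, hs', hc']
  simp only [dot, hNv, hTv, Jrot, Prod.fst_sub, Prod.snd_sub, Prod.fst_add, Prod.snd_add,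
    Prod.smul_fst, Prod.smul_snd, Prod.fst_neg, Prod.snd_neg, smul_eq_mul]
  ring
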